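/- Let f be slice-regular on an axially symmetric domain Ω of a hypercomplex subspace M of dimension m+1 > 2 (associative case) and suppose Δ_B f = 0. Then f is affine: f(x) = x a + b for some a, b ∈ A. -/

import Mathlib

noncomputable section
namespace PaperStmt

variable {A : Type*} [NormedRing A] [NormedAlgebra ℝ A] {m : ℕ}

/-- Partial derivative in the `i`-th coordinate direction. -/
def pd (i : Fin (m + 1)) (f : (Fin (m + 1) → ℝ) → A) : (Fin (m + 1) → ℝ) → A :=
  fun x => fderiv ℝ f x (Pi.single i 1)

/-- The Cauchy–Riemann operator `∂̄_B = (1/2)(∂₀ + ∑ᵢ vᵢ ∂ᵢ)` induced by the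
basis `B = (1, v₁, …, v_m)` (so `v 0 = 1`). -/
def dbar (v : Fin (m + 1) → A) (f : (Fin (m + 1) → ℝ) → A) : (Fin (m + 1) → ℝ) → A :=
  fun x => (2 : ℝ)⁻¹ •
    (pd 0 f x + ∑ i ∈ Finset.univ.erase (0 : Fin (m + 1)), v i * pd i f x)

/-- The conjugated Cauchy–Riemann operator `∂_B = (1/2)(∂₀ - ∑ᵢ vᵢ ∂ᵢ)`. -/
def dconj (v : Fin (m + 1) → A) (f : (Fin (m + 1) → ℝ) → A) : (Fin (m + 1) → ℝ) → A :=
  fun x => (2 : ℝ)⁻¹ •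
    (pd 0 f x - ∑ i ∈ Finset.univ.erase (0 : Fin (m + 1)), v i * pd i f x)

/-- The Laplacian `Δ_B = ∑ᵢ ∂ᵢ²` of `M ≅ ℝ^{m+1}`. -/
def lap (f : (Fin (m + 1) → ℝ) → A) : (Fin (m + 1) → ℝ) → A :=
  fun x => ∑ i : Fin (m + 1), pd i (pd i f) x

/-- The norm `β = ‖Im x‖` of the imaginary part of the point with
coordinates `x`. -/
def nIm (x : Fin (m + 1) → ℝ) : ℝ :=
  Real.sqrt (∑ i ∈ Finset.univ.erase (0 : Fin (m + 1)), (x i) ^ 2)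

/-- The point `α + iβ` of the complex half-plane corresponding to `x`. -/
def zeta (x : Fin (m + 1) → ℝ) : ℂ := ⟨x 0, nIm x⟩

/-- The imaginary part `Im(x) = ∑_{i=1}^m xᵢ vᵢ` of the point of `M` with
coordinates `x`. -/
def imv (v : Fin (m + 1) → A) (x : Fin (m + 1) → ℝ) : A :=
  ∑ i ∈ Finset.univ.erase (0 : Fin (m + 1)), x i • v i

/-- The point of `M` with coordinates `x` w.r.t. the basis `(1, v₁, …, v_m)`. -/
def iot (v : Fin (m + 1) → A) (x : Fin (m + 1) → ℝ) : A :=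
  ∑ i : Fin (m + 1), x i • v i

/-- The slice function `I(F₁ + √-1 F₂)` induced on (the coordinates of) `M` by
the stem function with components `F₁, F₂`:
`f(α + Jβ) = F₁(α+iβ) + J F₂(α+iβ)` with `β = ‖Im x‖ ≥ 0`, `J = Im(x)/β`. -/
def sfun (v : Fin (m + 1) → A) (F₁ F₂ : ℂ → A) : (Fin (m + 1) → ℝ) → A :=
  fun x => F₁ (zeta x) + imv v x * ((nIm x)⁻¹ • F₂ (zeta x))

/-- The spherical derivative `f'ₛ(x) = β⁻¹ F₂(α+iβ)` of the slice function
induced by the stem components `(F₁, F₂)`. -/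
def sder (F₂ : ℂ → A) : (Fin (m + 1) → ℝ) → A :=
  fun x => (nIm x)⁻¹ • F₂ (zeta x)

/-- Real partial derivative of a stem component along `1 ∈ ℂ`. -/
def d1 (F : ℂ → A) (z : ℂ) : A := fderiv ℝ F z 1

/-- Real partial derivative of a stem component along `i ∈ ℂ`. -/
def dI (F : ℂ → A) (z : ℂ) : A := fderiv ℝ F z Complex.I

/-- The tangential operator `L_{ij} = xᵢ ∂ⱼ - xⱼ ∂ᵢ`. -/
def Lop (i j : Fin (m + 1)) (f : (Fin (m + 1) → ℝ) → A) : (Fin (m + 1) → ℝ) → A :=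
  fun x => x i • pd j f x - x j • pd i f x

/-- The spherical Dirac operator `Γ_B = -(1/2) ∑_{i,j=1}^m vᵢ (vⱼ L_{ij})`. -/
def Gam (v : Fin (m + 1) → A) (f : (Fin (m + 1) → ℝ) → A) : (Fin (m + 1) → ℝ) → A :=
  fun x => -((2 : ℝ)⁻¹ •
    ∑ i ∈ Finset.univ.erase (0 : Fin (m + 1)),
      ∑ j ∈ Finset.univ.erase (0 : Fin (m + 1)), v i * (v j * Lop i j f x))

open Filter Topology

lemma imv_mul_self (v : Fin (m + 1) → A)
    (hsq : ∀ i : Fin (m + 1), i ≠ 0 → v i * v i = -1)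
    (hanti : ∀ i j : Fin (m + 1), i ≠ 0 → j ≠ 0 → i ≠ j → v i * v j = -(v j * v i))
    (x : Fin (m + 1) → ℝ) : imv v x * imv v x = -((nIm x ^ 2) • (1 : A)) := by
  have hr : nIm x ^ 2 = ∑ i ∈ Finset.univ.erase (0 : Fin (m + 1)), (x i) ^ 2 :=
    Real.sq_sqrt (Finset.sum_nonneg fun i _ => sq_nonneg _)
  have h1 : imv v x * imv v x = ∑ i ∈ Finset.univ.erase (0 : Fin (m + 1)),
      ∑ j ∈ Finset.univ.erase (0 : Fin (m + 1)), (x i * x j) • (v i * v j) := by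
    simp only [imv, Finset.sum_mul_sum, smul_mul_smul_comm]
  have h2 : imv v x * imv v x = ∑ i ∈ Finset.univ.erase (0 : Fin (m + 1)),
      ∑ j ∈ Finset.univ.erase (0 : Fin (m + 1)), (x i * x j) • (v j * v i) := by
    rw [h1, Finset.sum_comm]
    simp only [mul_comm (x _) (x _)]
  have h3 : imv v x * imv v x + imv v x * imv v x = (2 : ℝ) • -((nIm x ^ 2) • (1 : A)) := by
    nth_rewrite 1 [h1]
    rw [h2, ← Finset.sum_add_distrib, hr, Finset.sum_smul, ← Finset.sum_neg_distrib,
      Finset.smul_sum]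
    refine Finset.sum_congr rfl fun i hi => ?_
    have hi0 := Finset.ne_of_mem_erase hi
    rw [← Finset.sum_add_distrib, Finset.sum_eq_single_of_mem i hi]
    · rw [hsq i hi0]
      module
    · intro j hj hji
      rw [hanti i j hi0 (Finset.ne_of_mem_erase hj) hji.symm]
      module
  rw [← two_smul ℝ] at h3
  exact smul_right_injective A (two_ne_zero : (2 : ℝ) ≠ 0) h3

lemma hasFDerivAt_nIm {x : Fin (m + 1) → ℝ} (hx : nIm x ≠ 0) :
    ∃ L : (Fin (m + 1) → ℝ) →L[ℝ] ℝ, HasFDerivAt nIm L x ∧ L (Pi.single 0 1) = 0 ∧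
      ∀ i, i ≠ 0 → L (Pi.single i 1) = x i * (nIm x)⁻¹ := by
  have hs : HasFDerivAt
      (fun y : Fin (m + 1) → ℝ => ∑ i ∈ Finset.univ.erase (0 : Fin (m + 1)), (y i) ^ 2)
      (∑ i ∈ Finset.univ.erase (0 : Fin (m + 1)),
        (2 * x i) • ContinuousLinearMap.proj (R := ℝ) (φ := fun _ => ℝ) i) x := by
    refine HasFDerivAt.fun_sum fun i _ => ?_
    simpa using (hasFDerivAt_apply (𝕜 := ℝ) i x).pow 2
  have hne : ∑ i ∈ Finset.univ.erase (0 : Fin (m + 1)), (x i) ^ 2 ≠ 0 := by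
    intro h
    exact hx (by rw [nIm, h, Real.sqrt_zero])
  refine ⟨_, hs.sqrt hne, ?_, ?_⟩
  · simp [Pi.single_apply]
  · intro i hi
    have : √(∑ j ∈ Finset.univ.erase (0 : Fin (m + 1)), (x j) ^ 2) = nIm x := rfl
    simp only [this, smul_apply, sum_apply, ContinuousLinearMap.proj_apply, Pi.single_apply, smul_eq_mul, mul_ite, mul_one, mul_zero,
      Finset.sum_ite_eq', Finset.mem_erase, Finset.mem_univ]
    simp [hi]
    field_simp

lemma hasFDerivAt_zeta {x : Fin (m + 1) → ℝ} (hx : nIm x ≠ 0) :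
    ∃ L : (Fin (m + 1) → ℝ) →L[ℝ] ℂ, HasFDerivAt zeta L x ∧ L (Pi.single 0 1) = 1 ∧
      ∀ i, i ≠ 0 → L (Pi.single i 1) = (x i * (nIm x)⁻¹) • Complex.I := by
  obtain ⟨N, hN, hN0, hNi⟩ := hasFDerivAt_nIm hx
  have hz : (zeta : (Fin (m + 1) → ℝ) → ℂ) =
      fun y => y 0 • (1 : ℂ) + nIm y • Complex.I := by
    funext y
    apply Complex.ext <;> simp [zeta]
  rw [hz]
  refine ⟨_, ((hasFDerivAt_apply (𝕜 := ℝ) (0 : Fin (m + 1)) x).smul_const (1 : ℂ)).add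
    (hN.smul_const Complex.I), ?_, ?_⟩
  · simp [hN0]
  · intro i hi
    simp [hNi i hi, hi.symm]

lemma continuous_nIm : Continuous (nIm : (Fin (m + 1) → ℝ) → ℝ) := by
  unfold nIm
  fun_prop

lemma continuous_zeta : Continuous (zeta : (Fin (m + 1) → ℝ) → ℂ) := by
  have hz : (zeta : (Fin (m + 1) → ℝ) → ℂ) =
      fun y => y 0 • (1 : ℂ) + nIm y • Complex.I := by
    funext y
    apply Complex.ext <;> simp [zeta]
  rw [hz]
  have := continuous_nIm (m := m)
  fun_prop

lemma hasFDerivAt_imv (v : Fin (m + 1) → A) (x : Fin (m + 1) → ℝ) :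
    ∃ L : (Fin (m + 1) → ℝ) →L[ℝ] A, HasFDerivAt (imv v) L x ∧ L (Pi.single 0 1) = 0 ∧
      ∀ i, i ≠ 0 → L (Pi.single i 1) = v i := by
  refine ⟨∑ i ∈ Finset.univ.erase (0 : Fin (m + 1)),
    (ContinuousLinearMap.proj (R := ℝ) (φ := fun _ => ℝ) i).smulRight (v i), ?_, ?_, ?_⟩
  · exact HasFDerivAt.fun_sum fun i _ => (hasFDerivAt_apply (𝕜 := ℝ) i x).smul_const (v i)
  · simp [Pi.single_apply]
  · intro i hi
    simp [Pi.single_apply, hi]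

lemma hasFDerivAt_sder {F : ℂ → A} {x : Fin (m + 1) → ℝ} (hx : nIm x ≠ 0)
    (hF : DifferentiableAt ℝ F (zeta x)) :
    ∃ L : (Fin (m + 1) → ℝ) →L[ℝ] A, HasFDerivAt (sder F) L x ∧
      L (Pi.single 0 1) = (nIm x)⁻¹ • d1 F (zeta x) ∧
      ∀ i, i ≠ 0 → L (Pi.single i 1) =
        (x i * (nIm x)⁻¹ ^ 2) • (dI F (zeta x) - (nIm x)⁻¹ • F (zeta x)) := by
  obtain ⟨N, hN, hN0, hNi⟩ := hasFDerivAt_nIm hx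
  obtain ⟨Z, hZ, hZ0, hZi⟩ := hasFDerivAt_zeta hx
  have hinv := (hasDerivAt_inv hx).comp_hasFDerivAt x hN
  refine ⟨_, hinv.smul (hF.hasFDerivAt.comp x hZ), ?_, ?_⟩
  · simp [hN0, hZ0, d1]
  · intro i hi
    have hFZ : fderiv ℝ F (zeta x) (Z (Pi.single i 1)) = (x i * (nIm x)⁻¹) • dI F (zeta x) := by
      rw [hZi i hi, map_smul, dI]
    simp [hNi i hi, hFZ]
    module

/-- At a point off the real axis, a slice-regular function is differentiable and all its
partial derivatives are determined by `∂₀ f` and the spherical derivative. -/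
lemma sfun_partials (v : Fin (m + 1) → A)
    (hsq : ∀ i : Fin (m + 1), i ≠ 0 → v i * v i = -1)
    (hanti : ∀ i j : Fin (m + 1), i ≠ 0 → j ≠ 0 → i ≠ j → v i * v j = -(v j * v i))
    {F₁ F₂ : ℂ → A} {x : Fin (m + 1) → ℝ} (hx : nIm x ≠ 0)
    (hF1 : DifferentiableAt ℝ F₁ (zeta x)) (hF2 : DifferentiableAt ℝ F₂ (zeta x))
    (hreg : d1 F₁ (zeta x) = dI F₂ (zeta x) ∧ dI F₁ (zeta x) = -(d1 F₂ (zeta x))) :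
    DifferentiableAt ℝ (sfun v F₁ F₂) x ∧
    pd 0 (sfun v F₁ F₂) x =
      d1 F₁ (zeta x) + imv v x * ((nIm x)⁻¹ • d1 F₂ (zeta x)) ∧
    ∀ i, i ≠ 0 → pd i (sfun v F₁ F₂) x = v i * sder F₂ x +
      x i • (((nIm x)⁻¹ ^ 2 • imv v x) * (pd 0 (sfun v F₁ F₂) x - sder F₂ x)) := by
  obtain ⟨Z, hZ, hZ0, hZi⟩ := hasFDerivAt_zeta hx
  obtain ⟨V, hV, hV0, hVi⟩ := hasFDerivAt_imv v x
  obtain ⟨G, hG, hG0, hGi⟩ := hasFDerivAt_sder hx hF2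
  have hf := (hF1.hasFDerivAt.comp x hZ).add (hV.mul' hG)
  change HasFDerivAt (sfun v F₁ F₂) _ x at hf
  have h0 : pd 0 (sfun v F₁ F₂) x =
      d1 F₁ (zeta x) + imv v x * ((nIm x)⁻¹ • d1 F₂ (zeta x)) := by
    rw [pd, hf.fderiv]
    simp [hZ0, hV0, hG0, d1]
  refine ⟨hf.differentiableAt, h0, fun i hi => ?_⟩
  have hsqv : imv v x * (imv v x * d1 F₂ (zeta x)) = -((nIm x ^ 2) • d1 F₂ (zeta x)) := by
    rw [← mul_assoc, imv_mul_self v hsq hanti]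
    simp
  have e1 : pd i (sfun v F₁ F₂) x = (x i * (nIm x)⁻¹) • dI F₁ (zeta x) + v i * sder F₂ x +
      imv v x * ((x i * (nIm x)⁻¹ ^ 2) • (dI F₂ (zeta x) - (nIm x)⁻¹ • F₂ (zeta x))) := by
    have hFZ : fderiv ℝ F₁ (zeta x) (Z (Pi.single i 1)) = (x i * (nIm x)⁻¹) • dI F₁ (zeta x) := by
      rw [hZi i hi, map_smul, dI]
    rw [pd, hf.fderiv]
    simp [hFZ, hVi i hi, hGi i hi]
    abel
  rw [e1, h0, hreg.2, ← hreg.1]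
  simp only [sder, mul_add, mul_sub, mul_smul_comm, smul_mul_assoc, hsqv, smul_add, smul_sub,
    smul_neg, smul_smul]
  have e2 : x i * ((nIm x)⁻¹ * ((nIm x)⁻¹ ^ 2 * nIm x ^ 2)) = x i * (nIm x)⁻¹ := by
    field_simp
  simp only [e2, mul_assoc]
  module

lemma fderiv_eq_mul_fderiv_of_eventually_line {E : Type*} [NormedAddCommGroup E]
    [NormedSpace ℝ E] {P Q : E → A} {c : A} {x e : E} (hP : DifferentiableAt ℝ P x)
    (hQ : DifferentiableAt ℝ Q x)
    (h : ∀ᶠ t : ℝ in 𝓝 0, P (x + t • e) = c * Q (x + t • e)) :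
    fderiv ℝ P x e = c * fderiv ℝ Q x e := by
  have h1 : HasDerivAt (fun t : ℝ => P (x + t • e)) (fderiv ℝ P x e) 0 :=
    hP.hasFDerivAt.hasLineDerivAt e
  have h2 : HasDerivAt (fun t : ℝ => Q (x + t • e)) (fderiv ℝ Q x e) 0 :=
    hQ.hasFDerivAt.hasLineDerivAt e
  exact h1.unique ((h2.const_mul c).congr_of_eventuallyEq h)

/-- A function `y ↦ y i • K y` is differentiable at any zero of the coordinate `y i` at which
`K` is continuous. -/
lemma hasFDerivAt_coord_smul_of_eq_zero {K : (Fin (m + 1) → ℝ) → A} {x : Fin (m + 1) → ℝ}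
    {i : Fin (m + 1)} (hi : x i = 0) (hK : ContinuousAt K x) :
    HasFDerivAt (fun y : Fin (m + 1) → ℝ => y i • K y)
      ((ContinuousLinearMap.proj (R := ℝ) (φ := fun _ => ℝ) i).smulRight (K x)) x := by
  have h1 : (fun y : Fin (m + 1) → ℝ => y i) =O[𝓝 x] fun y => y - x := by
    refine Asymptotics.IsBigO.of_bound 1 (Eventually.of_forall fun y => ?_)
    simpa [hi] using norm_le_pi_norm (y - x) i
  have h2 : (fun y => K y - K x) =o[𝓝 x] fun _ => (1 : ℝ) := by
    rw [Asymptotics.isLittleO_one_iff]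
    simpa using hK.sub_const (K x)
  refine .of_isLittleO ?_
  have h3 := (h1.norm_right.smul_isLittleO h2).congr_right
    (g₂ := fun y => ‖y - x‖) fun y => by simp
  refine (h3.congr_left fun y => ?_).of_norm_right
  simp [hi, smul_sub]

lemma nIm_sq_of_slice {x : Fin (m + 1) → ℝ} {k : Fin (m + 1)} (hk : k ≠ 0)
    (hxk : ∀ i, i ≠ 0 → i ≠ k → x i = 0) : nIm x ^ 2 = x k ^ 2 := by
  rw [nIm, Real.sq_sqrt (Finset.sum_nonneg fun i _ => sq_nonneg _),
    Finset.sum_eq_single_of_mem k (by simp [hk])]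
  intro i hi hik
  simp [hxk i (Finset.ne_of_mem_erase hi) hik]

lemma imv_of_slice (v : Fin (m + 1) → A) {x : Fin (m + 1) → ℝ} {k : Fin (m + 1)} (hk : k ≠ 0)
    (hxk : ∀ i, i ≠ 0 → i ≠ k → x i = 0) : imv v x = x k • v k := by
  rw [imv, Finset.sum_eq_single_of_mem k (by simp [hk])]
  intro i hi hik
  simp [hxk i (Finset.ne_of_mem_erase hi) hik]

/-- At a non-real point of the complex slice through `v k`, harmonicity of a slice-regular
function forces `∂₀ f` to equal the spherical derivative. -/
lemma pd_zero_eq_sder_of_lap_eq_zero (hm : 2 ≤ m) (v : Fin (m + 1) → A)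
    (hsq : ∀ i : Fin (m + 1), i ≠ 0 → v i * v i = -1)
    (hanti : ∀ i j : Fin (m + 1), i ≠ 0 → j ≠ 0 → i ≠ j → v i * v j = -(v j * v i))
    {D : Set ℂ} (hD : IsOpen D) {F₁ F₂ : ℂ → A}
    (hF1 : ContDiffOn ℝ 1 F₁ D) (hF2 : ContDiffOn ℝ 1 F₂ D)
    (hreg : ∀ z ∈ D, d1 F₁ z = dI F₂ z ∧ dI F₁ z = -(d1 F₂ z))
    {x : Fin (m + 1) → ℝ} {k : Fin (m + 1)} (hk : k ≠ 0)
    (hxk : ∀ i, i ≠ 0 → i ≠ k → x i = 0) (hxD : zeta x ∈ D) (hx : nIm x ≠ 0)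
    (hlap : lap (sfun v F₁ F₂) x = 0) :
    pd 0 (sfun v F₁ F₂) x = sder F₂ x := by
  set f := sfun v F₁ F₂ with hf
  have hdiff1 : ∀ z ∈ D, DifferentiableAt ℝ F₁ z := fun z hz =>
    (hF1.differentiableOn one_ne_zero).differentiableAt (hD.mem_nhds hz)
  have hdiff2 : ∀ z ∈ D, DifferentiableAt ℝ F₂ z := fun z hz =>
    (hF2.differentiableOn one_ne_zero).differentiableAt (hD.mem_nhds hz)
  have hU : ∀ᶠ y in 𝓝 x, zeta y ∈ D ∧ nIm y ≠ 0 :=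
    (continuous_zeta.continuousAt.eventually (hD.mem_nhds hxD)).and
      (continuous_nIm.continuousAt.eventually_ne hx)
  have hpart : ∀ y, zeta y ∈ D ∧ nIm y ≠ 0 → _ := fun y hy =>
    sfun_partials v hsq hanti hy.2 (hdiff1 _ hy.1) (hdiff2 _ hy.1) (hreg _ hy.1)
  obtain ⟨V, hV, -, -⟩ := hasFDerivAt_imv v x
  obtain ⟨N, hN, -, -⟩ := hasFDerivAt_nIm hx
  obtain ⟨G, hG, -, hGi⟩ := hasFDerivAt_sder hx (hdiff2 _ hxD)
  have hcont : ContinuousAt (pd 0 f) x := by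
    have hz := (continuous_zeta (m := m)).continuousAt (x := x)
    have hd : ∀ {F : ℂ → A}, ContDiffOn ℝ 1 F D → ContinuousAt (fun y => d1 F (zeta y)) x :=
      fun {F} hF => ContinuousAt.comp (g := d1 F)
        (((hF.continuousOn_fderiv_of_isOpen hD le_rfl).continuousAt
          (hD.mem_nhds hxD)).clm_apply continuousAt_const) hz
    have h1 : ContinuousAt (fun y => d1 F₁ (zeta y) +
        imv v y * ((nIm y)⁻¹ • d1 F₂ (zeta y))) x :=
      (hd hF1).add (hV.continuousAt.mul ((hN.continuousAt.inv₀ hx).smul (hd hF2)))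
    exact h1.congr (hU.mono fun y hy => ((hpart y hy).2.1).symm)
  have hQ : DifferentiableAt ℝ (fun y => (nIm y)⁻¹ ^ 2 • imv v y) x :=
    ((hN.differentiableAt.inv hx).pow 2).smul hV.differentiableAt
  set K : (Fin (m + 1) → ℝ) → A :=
    fun y => ((nIm y)⁻¹ ^ 2 • imv v y) * (pd 0 f y - sder F₂ y) with hKdef
  have hK : ContinuousAt K x := hQ.continuousAt.mul (hcont.sub hG.continuousAt)
  have hpd : ∀ i, i ≠ 0 → pd i f =ᶠ[𝓝 x] fun y => v i * sder F₂ y + y i • K y := fun i hi =>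
    hU.mono fun y hy => (hpart y hy).2.2 i hi
  have hother : ∀ i, i ≠ 0 → i ≠ k → pd i (pd i f) x = K x := by
    intro i hi hik
    have h1 := (hG.const_mul (v i)).add (hasFDerivAt_coord_smul_of_eq_zero (hxk i hi hik) hK)
    have h2 := h1.congr_of_eventuallyEq (hpd i hi)
    rw [pd, h2.fderiv]
    simp [hGi i hi, hxk i hi hik]
  have hxk0 : x k ≠ 0 := by
    intro h
    apply hx
    have := nIm_sq_of_slice hk hxk
    rw [h] at this
    simpa using this
  -- the one-dimensional Cauchy–Riemann equation on the slice
  have hCR : ∀ y, (∀ i, i ≠ 0 → i ≠ k → y i = 0) → zeta y ∈ D ∧ nIm y ≠ 0 →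
      pd k f y = v k * pd 0 f y := by
    intro y hyk hy
    have hy2 := nIm_sq_of_slice hk hyk
    have hyk0 : y k ≠ 0 := by
      intro h
      rw [h] at hy2
      exact hy.2 (by simpa using hy2)
    have e : y k * ((y k ^ 2)⁻¹ * y k) = 1 := by field_simp
    rw [(hpart y hy).2.2 k hk, inv_pow, hy2, imv_of_slice v hk hyk, smul_smul, smul_mul_assoc,
      smul_smul, e, one_smul, ← hf]
    noncomm_ring
  have hline : ∀ e : Fin (m + 1) → ℝ, (∀ i, i ≠ 0 → i ≠ k → e i = 0) →
      ∀ᶠ t : ℝ in 𝓝 0, pd k f (x + t • e) = v k * pd 0 f (x + t • e) := by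
    intro e he
    have hc : Tendsto (fun t : ℝ => x + t • e) (𝓝 0) (𝓝 x) := by
      have : Continuous fun t : ℝ => x + t • e := by fun_prop
      simpa using this.tendsto 0
    filter_upwards [hc.eventually hU] with t ht
    exact hCR _ (fun i hi hik => by simp [he i hi hik, hxk i hi hik]) ht
  have hplane : pd 0 (pd 0 f) x + pd k (pd k f) x = 0 := by
    by_cases hP : DifferentiableAt ℝ (pd 0 f) x
    · have hKd : DifferentiableAt ℝ K x := hQ.mul (hP.sub hG.differentiableAt)
      have hpdd : ∀ i, DifferentiableAt ℝ (pd i f) x := by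
        intro i
        by_cases hi : i = 0
        · rwa [hi]
        · exact ((hG.differentiableAt.const_mul (v i)).add
            ((differentiableAt_apply (𝕜 := ℝ) i x).smul hKd)).congr_of_eventuallyEq (hpd i hi)
      have hfd : fderiv ℝ f = fun y => ∑ i, (ContinuousLinearMap.proj (R := ℝ)
          (φ := fun _ : Fin (m + 1) => ℝ) i).smulRight (pd i f y) := by
        funext y
        ext w
        conv_lhs => rw [pi_eq_sum_univ' w]
        simp [pd, map_sum]
      have hfdd : DifferentiableAt ℝ (fderiv ℝ f) x := by
        rw [hfd]
        refine DifferentiableAt.fun_sum fun i _ => ?_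
        exact ((ContinuousLinearMap.smulRightL ℝ (Fin (m + 1) → ℝ) A
          (ContinuousLinearMap.proj i)).differentiableAt).comp x (hpdd i)
      have hsymm := second_derivative_symmetric_of_eventually
        (hU.mono fun y hy => ((hpart y hy).1).hasFDerivAt) hfdd.hasFDerivAt
        (Pi.single 0 1) (Pi.single k 1)
      have hap : ∀ i w, fderiv ℝ (pd i f) x w = fderiv ℝ (fderiv ℝ f) x w (Pi.single i 1) := by
        intro i w
        have := (hfdd.hasFDerivAt.clm_apply
          (hasFDerivAt_const (Pi.single i (1 : ℝ) : Fin (m + 1) → ℝ) x)).fderiv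
        rw [show pd i f = fun y => fderiv ℝ f y (Pi.single i 1) from rfl, this]
        simp
      have hk1 := fderiv_eq_mul_fderiv_of_eventually_line (hpdd k) hP
        (hline (Pi.single k 1) fun i _ hik => by simp [hik])
      have h01 := fderiv_eq_mul_fderiv_of_eventually_line (hpdd k) hP
        (hline (Pi.single 0 1) fun i hi _ => by simp [hi])
      have hmix : fderiv ℝ (pd 0 f) x (Pi.single k 1) = fderiv ℝ (pd k f) x (Pi.single 0 1) := by
        rw [hap, hap, hsymm]
      change fderiv ℝ (pd 0 f) x (Pi.single 0 1) + fderiv ℝ (pd k f) x (Pi.single k 1) = 0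
      rw [hk1, hmix, h01, ← mul_assoc, hsq k hk]
      simp
    · have hPk : ¬ DifferentiableAt ℝ (pd k f) x := by
        intro hPk
        apply hP
        have h1 : DifferentiableAt ℝ (fun y => -(y k)⁻¹ •
            (imv v y * (pd k f y - v k * sder F₂ y)) + sder F₂ y) x :=
          (((differentiableAt_apply (𝕜 := ℝ) k x).inv hxk0).neg.smul (hV.differentiableAt.mul
            (hPk.sub (hG.differentiableAt.const_mul (v k))))).add hG.differentiableAt
        refine h1.congr_of_eventuallyEq ?_
        filter_upwards [hU, (continuous_apply k).continuousAt.eventually_ne hxk0] with y hy hyk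
        rw [(hpart y hy).2.2 k hk, add_sub_cancel_left, ← hf, mul_smul_comm, ← mul_assoc,
          mul_smul_comm, imv_mul_self v hsq hanti]
        have hy2 := hy.2
        simp only [smul_neg, neg_mul, smul_mul_assoc, one_mul, smul_smul, neg_smul, neg_neg]
        have e : (y k)⁻¹ * (y k * ((nIm y)⁻¹ ^ 2 * nIm y ^ 2)) = 1 := by field_simp
        rw [e]
        simp
      have e0 : pd 0 (pd 0 f) x = 0 := by
        rw [pd, fderiv_zero_of_not_differentiableAt hP]; simp
      have ek : pd k (pd k f) x = 0 := by
        rw [pd, fderiv_zero_of_not_differentiableAt hPk]; simp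
      rw [e0, ek, add_zero]
  have hsum : lap f x = ((m - 1 : ℕ) : ℝ) • K x := by
    rw [lap, ← Finset.add_sum_erase _ _ (Finset.mem_univ (0 : Fin (m + 1))),
      ← Finset.add_sum_erase _ _ (show k ∈ Finset.univ.erase (0 : Fin (m + 1)) by simp [hk]),
      ← add_assoc, hplane, zero_add, Finset.sum_congr rfl (g := fun _ => K x),
      Finset.sum_const, Finset.card_erase_of_mem (by simp [hk]),
      Finset.card_erase_of_mem (Finset.mem_univ _), Finset.card_univ, Fintype.card_fin,
      Nat.cast_smul_eq_nsmul]
    · rfl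
    · intro i hi
      simp only [Finset.mem_erase] at hi
      exact hother i hi.2.1 hi.1
  have hK0 : K x = 0 := by
    rw [hlap] at hsum
    refine (smul_eq_zero.1 hsum.symm).resolve_left ?_
    exact_mod_cast (by omega : m - 1 ≠ 0)
  have h0 : imv v x * K x = -(pd 0 f x - sder F₂ x) := by
    have e : (nIm x)⁻¹ ^ 2 * nIm x ^ 2 = 1 := by field_simp
    simp only [hKdef]
    rw [← mul_assoc, mul_smul_comm, imv_mul_self v hsq hanti, smul_neg, smul_smul, e]
    simp
  rw [hK0, mul_zero] at h0
  exact sub_eq_zero.1 (neg_eq_zero.1 h0.symm)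

lemma zeta_im_nonneg (x : Fin (m + 1) → ℝ) : 0 ≤ (zeta x).im := Real.sqrt_nonneg _

/-- A continuous function on an open set `D` which is locally constant on the part of `D` in
the open upper half-plane is constant on the part of `D` in the closed upper half-plane, provided
the latter corresponds to a connected set in `ℝ^{m+1}`. -/
lemma eq_of_hasFDerivAt_zero_upper {D : Set ℂ} (hD : IsOpen D)
    (hconn : IsPreconnected {x : Fin (m + 1) → ℝ | zeta x ∈ D}) {H : ℂ → A}
    (hH : ContinuousOn H D) (hH0 : ∀ z ∈ D, 0 < z.im → HasFDerivAt H (0 : ℂ →L[ℝ] A) z)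
    {x y : Fin (m + 1) → ℝ} (hx : zeta x ∈ D) (hy : zeta y ∈ D) :
    H (zeta x) = H (zeta y) := by
  refine hconn.induction₂ (fun a b => H (zeta a) = H (zeta b)) ?_
    (fun _ _ _ _ _ _ h h' => h.trans h') (fun _ _ _ _ h => h.symm) hx hy
  intro p hp
  obtain ⟨ε, hε, hball⟩ := Metric.isOpen_iff.1 hD _ hp
  have hconst : ∀ w₁ ∈ Metric.ball (zeta p) ε ∩ {z : ℂ | 0 < z.im},
      ∀ w₂ ∈ Metric.ball (zeta p) ε ∩ {z : ℂ | 0 < z.im}, H w₁ = H w₂ := by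
    have hopen : IsOpen (Metric.ball (zeta p) ε ∩ {z : ℂ | 0 < z.im}) :=
      Metric.isOpen_ball.inter (isOpen_lt continuous_const Complex.continuous_im)
    have hd : ∀ z ∈ Metric.ball (zeta p) ε ∩ {z : ℂ | 0 < z.im},
        HasFDerivAt H (0 : ℂ →L[ℝ] A) z := fun z hz => hH0 z (hball hz.1) hz.2
    intro w₁ h₁ w₂ h₂
    exact hopen.is_const_of_fderiv_eq_zero (𝕜 := ℝ)
      ((convex_ball _ _).inter (convex_halfSpace_im_gt 0)).isPreconnected
      (fun z hz => (hd z hz).differentiableAt.differentiableWithinAt)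
      (fun z hz => (hd z hz).fderiv) h₁ h₂
  have hnear : ∀ᶠ q in 𝓝 p, zeta q ∈ Metric.ball (zeta p) ε :=
    continuous_zeta.continuousAt.eventually (Metric.ball_mem_nhds _ hε)
  refine (hnear.filter_mono nhdsWithin_le_nhds).mono fun q hq => ?_
  have hpath : ∀ w : ℂ, Tendsto (fun t : ℝ => w + t * Complex.I) (𝓝[>] 0) (𝓝 w) := by
    intro w
    have : Continuous fun t : ℝ => w + t * Complex.I := by fun_prop
    simpa using (this.tendsto 0).mono_left nhdsWithin_le_nhds
  have hmem : ∀ w ∈ Metric.ball (zeta p) ε, 0 ≤ w.im →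
      ∀ᶠ t : ℝ in 𝓝[>] 0, w + t * Complex.I ∈ Metric.ball (zeta p) ε ∩ {z : ℂ | 0 < z.im} := by
    intro w hw hw0
    filter_upwards [hpath w (Metric.isOpen_ball.mem_nhds hw), self_mem_nhdsWithin] with t ht ht0
    refine ⟨ht, ?_⟩
    have : (0 : ℝ) < t := ht0
    simp
    linarith
  have hlim : ∀ w ∈ Metric.ball (zeta p) ε,
      Tendsto (fun t : ℝ => H (w + t * Complex.I)) (𝓝[>] 0) (𝓝 (H w)) := fun w hw =>
    (hH.continuousAt (hD.mem_nhds (hball hw))).tendsto.comp (hpath w)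
  have hpb := Metric.mem_ball_self (x := zeta p) hε
  refine tendsto_nhds_unique_of_eventuallyEq (hlim _ hpb) (hlim _ hq) ?_
  filter_upwards [hmem _ hpb (zeta_im_nonneg p), hmem _ hq (zeta_im_nonneg q)] with t h₁ h₂
  exact hconst _ h₁ _ h₂

lemma clm_complex_eq_zero {L : ℂ →L[ℝ] A} (h1 : L 1 = 0) (hI : L Complex.I = 0) : L = 0 := by
  refine ContinuousLinearMap.ext fun w => ?_
  have hw : w = w.re • (1 : ℂ) + w.im • Complex.I := by
    apply Complex.ext <;> simp
  rw [hw, map_add, map_smul, map_smul, h1, hI]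
  simp

/-- Every point of the open upper half-plane is attained by `zeta` on the slice through the
`k`-th coordinate direction, on either side of the real axis. -/
lemma exists_slice_point {k : Fin (m + 1)} (hk : k ≠ 0) {s : ℝ} (hs : s ^ 2 = 1) {z : ℂ}
    (hz0 : 0 < z.im) : ∃ x : Fin (m + 1) → ℝ,
      (∀ i, i ≠ 0 → i ≠ k → x i = 0) ∧ x k = s * z.im ∧ zeta x = z := by
  set x : Fin (m + 1) → ℝ := Pi.single 0 z.re + Pi.single k (s * z.im) with hxdef
  have hxk : ∀ i, i ≠ 0 → i ≠ k → x i = 0 := fun i hi hik => by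
    simp [hxdef, hi, hik]
  have hxl : x k = s * z.im := by simp [hxdef, hk]
  refine ⟨x, hxk, hxl, Complex.ext ?_ ?_⟩
  · simp [zeta, hxdef, hk.symm]
  · have h1 := nIm_sq_of_slice hk hxk
    rw [hxl, mul_pow, hs, one_mul] at h1
    exact (sq_eq_sq₀ (Real.sqrt_nonneg _) hz0.le).1 h1

/-- A harmonic slice-regular function has a stem function with `∂F₂/∂α = 0` and
`∂F₁/∂α = β⁻¹ F₂` in the open upper half-plane. -/
lemma stem_of_lap_eq_zero (hm : 2 ≤ m) (v : Fin (m + 1) → A)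
    (hsq : ∀ i : Fin (m + 1), i ≠ 0 → v i * v i = -1)
    (hanti : ∀ i j : Fin (m + 1), i ≠ 0 → j ≠ 0 → i ≠ j → v i * v j = -(v j * v i))
    {D : Set ℂ} (hD : IsOpen D) {F₁ F₂ : ℂ → A}
    (hF1 : ContDiffOn ℝ 1 F₁ D) (hF2 : ContDiffOn ℝ 1 F₂ D)
    (hreg : ∀ z ∈ D, d1 F₁ z = dI F₂ z ∧ dI F₁ z = -(d1 F₂ z))
    (hlap : ∀ x : Fin (m + 1) → ℝ, zeta x ∈ D → nIm x ≠ 0 → lap (sfun v F₁ F₂) x = 0)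
    {z : ℂ} (hz : z ∈ D) (hz0 : 0 < z.im) :
    d1 F₂ z = 0 ∧ d1 F₁ z = z.im⁻¹ • F₂ z := by
  have hk : Fin.last m ≠ 0 := Fin.last_eq_zero_iff.not.2 (by omega)
  have key : ∀ s : ℝ, s ^ 2 = 1 →
      d1 F₁ z + s • (v (Fin.last m) * d1 F₂ z) = z.im⁻¹ • F₂ z := by
    intro s hs
    obtain ⟨x, hxk, hxl, hzx⟩ := exists_slice_point hk hs hz0
    have hn : nIm x = z.im := congrArg Complex.im hzx
    have hn0 : nIm x ≠ 0 := by rw [hn]; exact hz0.ne'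
    have hxD : zeta x ∈ D := by rwa [hzx]
    have h1 := pd_zero_eq_sder_of_lap_eq_zero hm v hsq hanti hD hF1 hF2 hreg hk hxk hxD hn0
      (hlap x hxD hn0)
    rw [(sfun_partials v hsq hanti hn0
      ((hF1.differentiableOn one_ne_zero).differentiableAt (hD.mem_nhds hxD))
      ((hF2.differentiableOn one_ne_zero).differentiableAt (hD.mem_nhds hxD))
      (hreg _ hxD)).2.1, imv_of_slice v hk hxk, hxl, sder, hzx, hn, smul_mul_smul_comm] at h1
    rwa [mul_assoc, mul_inv_cancel₀ hz0.ne', mul_one] at h1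
  have hp := key 1 (by norm_num)
  have hn := key (-1) (by norm_num)
  have h2 : (2 : ℝ) • (v (Fin.last m) * d1 F₂ z) = 0 := by
    rw [two_smul]
    have h := hp.trans hn.symm
    rw [one_smul, neg_smul, one_smul] at h
    have h' := add_left_cancel h
    nth_rewrite 1 [h']
    exact neg_add_cancel _
  have h3 : v (Fin.last m) * d1 F₂ z = 0 := (smul_eq_zero.1 h2).resolve_left two_ne_zero
  refine ⟨?_, by simpa [h3] using hp⟩
  have h4 : v (Fin.last m) * (v (Fin.last m) * d1 F₂ z) = 0 := by rw [h3, mul_zero]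
  rw [← mul_assoc, hsq _ hk] at h4
  simpa using h4

/-- **Harmonic slice-regular functions are affine.**
Let `f` be slice-regular on an axially symmetric domain `Ω = {x : ζ(x) ∈ D}` of
a hypercomplex subspace `M` of dimension `m+1 > 2` (associative case), induced
by the holomorphic stem `(F₁, F₂)`.  If `Δ_B f = 0`, then `f` is an affine
function of the form `x a + b` with `a, b ∈ A`. -/
theorem harmonic_sliceRegular_is_affine
    (hm : 2 ≤ m)
    (v : Fin (m + 1) → A) (hv0 : v 0 = 1)
    (hsq : ∀ i : Fin (m + 1), i ≠ 0 → v i * v i = -1)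
    (hanti : ∀ i j : Fin (m + 1), i ≠ 0 → j ≠ 0 → i ≠ j → v i * v j = -(v j * v i))
    (D : Set ℂ) (hD : IsOpen D) (hDsym : ∀ z ∈ D, (starRingEnd ℂ) z ∈ D)
    (hconn : IsConnected {x : Fin (m + 1) → ℝ | zeta x ∈ D})
    (F₁ F₂ : ℂ → A)
    (hs1 : ∀ z ∈ D, F₁ ((starRingEnd ℂ) z) = F₁ z)
    (hs2 : ∀ z ∈ D, F₂ ((starRingEnd ℂ) z) = -F₂ z)
    (hF1 : ContDiffOn ℝ 1 F₁ D) (hF2 : ContDiffOn ℝ 1 F₂ D)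
    (hreg : ∀ z ∈ D, d1 F₁ z = dI F₂ z ∧ dI F₁ z = -(d1 F₂ z))
    (hlap : ∀ x : Fin (m + 1) → ℝ, zeta x ∈ D → nIm x ≠ 0 →
      lap (sfun v F₁ F₂) x = 0) :
    ∃ a b : A, ∀ x : Fin (m + 1) → ℝ, zeta x ∈ D →
      sfun v F₁ F₂ x = iot v x * a + b := by
  have hdiff1 : ∀ z ∈ D, DifferentiableAt ℝ F₁ z := fun z hz =>
    (hF1.differentiableOn one_ne_zero).differentiableAt (hD.mem_nhds hz)
  have hdiff2 : ∀ z ∈ D, DifferentiableAt ℝ F₂ z := fun z hz =>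
    (hF2.differentiableOn one_ne_zero).differentiableAt (hD.mem_nhds hz)
  have hstem : ∀ z ∈ D, 0 < z.im → d1 F₂ z = 0 ∧ d1 F₁ z = z.im⁻¹ • F₂ z := fun z hz hz0 =>
    stem_of_lap_eq_zero hm v hsq hanti hD hF1 hF2 hreg hlap hz hz0
  have hd1cont : ContinuousOn (d1 F₁) D :=
    (hF1.continuousOn_fderiv_of_isOpen hD le_rfl).clm_apply continuousOn_const
  have hd1zero : ∀ z ∈ D, 0 < z.im → HasFDerivAt (d1 F₁) (0 : ℂ →L[ℝ] A) z := by
    intro z hz hz0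
    have hinv := (hasDerivAt_inv hz0.ne').comp_hasFDerivAt z Complex.imCLM.hasFDerivAt
    have h1 := hinv.smul (hdiff2 z hz).hasFDerivAt
    have hev : ∀ᶠ w in 𝓝 z, d1 F₁ w = w.im⁻¹ • F₂ w := by
      filter_upwards [hD.mem_nhds hz,
        (isOpen_lt continuous_const Complex.continuous_im).mem_nhds hz0] with w hw hw0
      exact (hstem w hw hw0).2
    have h2 := h1.congr_of_eventuallyEq hev
    have e1 : fderiv ℝ F₂ z 1 = 0 := (hstem z hz hz0).1
    have eI : fderiv ℝ F₂ z Complex.I = z.im⁻¹ • F₂ z :=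
      (hreg z hz).1.symm.trans (hstem z hz hz0).2
    refine h2.congr_fderiv (clm_complex_eq_zero ?_ ?_)
    · simp [e1]
    · simp [eI]
      module
  obtain ⟨x₀, hx₀⟩ := hconn.nonempty
  have ha : ∀ x : Fin (m + 1) → ℝ, zeta x ∈ D → d1 F₁ (zeta x) = d1 F₁ (zeta x₀) :=
    fun x hx => eq_of_hasFDerivAt_zero_upper hD hconn.isPreconnected hd1cont hd1zero hx hx₀
  set a := d1 F₁ (zeta x₀) with hadef
  have hre : ∀ z : ℂ, HasFDerivAt (fun w : ℂ => w.re • a) (Complex.reCLM.smulRight a) z :=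
    fun z => Complex.reCLM.hasFDerivAt.smul_const a
  have hup : ∀ z ∈ D, 0 < z.im → d1 F₁ z = a := by
    intro z hz hz0
    obtain ⟨x, -, -, rfl⟩ := exists_slice_point
      (Fin.last_eq_zero_iff.not.2 (by omega : m ≠ 0)) (one_pow 2) hz0
    exact ha x hz
  have hb : ∀ x : Fin (m + 1) → ℝ, zeta x ∈ D →
      F₁ (zeta x) - (zeta x).re • a = F₁ (zeta x₀) - (zeta x₀).re • a := by
    intro x hx
    refine eq_of_hasFDerivAt_zero_upper (H := fun z => F₁ z - z.re • a) hD hconn.isPreconnected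
      (hF1.continuousOn.sub fun z _ => (hre z).continuousAt.continuousWithinAt) ?_ hx hx₀
    intro z hz hz0
    have e1 : fderiv ℝ F₁ z 1 = a := hup z hz hz0
    have eI : fderiv ℝ F₁ z Complex.I = 0 := by
      have := (hreg z hz).2
      rwa [(hstem z hz hz0).1, neg_zero] at this
    refine ((hdiff1 z hz).hasFDerivAt.sub (hre z)).congr_fderiv (clm_complex_eq_zero ?_ ?_)
    · simp [e1]
    · simp [eI]
  refine ⟨a, F₁ (zeta x₀) - (zeta x₀).re • a, fun x hx => ?_⟩
  have hiot : iot v x = x 0 • 1 + imv v x := by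
    rw [iot, imv, ← Finset.add_sum_erase _ _ (Finset.mem_univ (0 : Fin (m + 1))), hv0]
  have hF1x : F₁ (zeta x) = x 0 • a + (F₁ (zeta x₀) - (zeta x₀).re • a) := by
    rw [← hb x hx]
    exact (add_sub_cancel _ _).symm
  have himv : imv v x * ((nIm x)⁻¹ • F₂ (zeta x)) = imv v x * a := by
    rcases (Real.sqrt_nonneg _ : 0 ≤ nIm x).eq_or_lt with h | h
    · have hsum : ∑ i ∈ Finset.univ.erase (0 : Fin (m + 1)), (x i) ^ 2 = 0 :=
        (Real.sqrt_eq_zero (Finset.sum_nonneg fun i _ => sq_nonneg _)).1 h.symm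
      have hzero : imv v x = 0 := Finset.sum_eq_zero fun i hi => by
        rw [pow_eq_zero_iff two_ne_zero |>.1
          ((Finset.sum_eq_zero_iff_of_nonneg fun i _ => sq_nonneg _).1 hsum i hi), zero_smul]
      rw [hzero, zero_mul, zero_mul]
    · rw [← ha x hx, (hstem _ hx h).2]
      rfl
  rw [sfun, himv, hF1x, hiot, add_mul, smul_mul_assoc, one_mul]
  abel

end PaperStmt
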